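/- arXiv:1102.3199 — 2 statements merged into one kernel-verified Lean document; each statement's English description precedes it below -/
import Mathlib

section
/- Let a, b ∈ (0,1) with a ≥ b and a + b ≥ 1. Define affine maps W_-(x,y) = (a x, b y) and W_+(x,y) = (b x + 1 - b, a y + 1 - a) on ℝ², let S_- = {(x,y) : x + y ≤ 1} and S_+ = ℝ² \ S_-, let □ = [0,1]², and define W on compact subsets of □ by W(C) = (S_- ∩ W_-(C)) ∪ (closure(S_+) ∩ W_+(C)). Set R = ⋂_{k≥0} W^k(□). Then there exists a continuous, strictly increasing function Φ : [0,1] → [0,1] with Φ(0) = 0, Φ(1) = 1, satisfying Φ(1 - Φ(x)) = 1 - x for all x ∈ [0,1], such that R = {(x, Φ(x)) : x ∈ [0,1]}; in particular R is symmetric about the line x + y = 1 and both coordinate projections map R onto [0,1]. -/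
/-- `W₋(x,y) = (a x, b y)`. -/
def Wm (a b : ℝ) : ℝ × ℝ → ℝ × ℝ := fun p => (a * p.1, b * p.2)

/-- `W₊(x,y) = (b x + 1 - b, a y + 1 - a)`. -/
def Wp (a b : ℝ) : ℝ × ℝ → ℝ × ℝ := fun p => (b * p.1 + 1 - b, a * p.2 + 1 - a)

/-- `S₋ = {(x,y) : x + y ≤ 1}`. -/
def Sm : Set (ℝ × ℝ) := {p | p.1 + p.2 ≤ 1}

/-- `W(C) = (S₋ ∩ W₋(C)) ∪ (closure(S₊) ∩ W₊(C))` where `S₊ = ℝ² \ S₋`. -/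
def Wset (a b : ℝ) : Set (ℝ × ℝ) → Set (ℝ × ℝ) :=
  fun C => (Sm ∩ Wm a b '' C) ∪ (closure Smᶜ ∩ Wp a b '' C)

/-- The repeller `R = ⋂_{k≥0} W^k(□)`, `□ = [0,1]²`. -/
def repeller (a b : ℝ) : Set (ℝ × ℝ) :=
  ⋂ k : ℕ, (Wset a b)^[k] (Set.Icc (0:ℝ) 1 ×ˢ Set.Icc (0:ℝ) 1)

/-- Symmetry under reflection in `x + y = 1`. -/
def RSymm (C : Set (ℝ × ℝ)) : Prop := ∀ x y : ℝ, (x, y) ∈ C → (1 - y, 1 - x) ∈ C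

/-- A symmetric chain in the unit square which meets every antidiagonal. -/
structure RCurve (C : Set (ℝ × ℝ)) : Prop where
  symm : RSymm C
  box : ∀ x y : ℝ, (x, y) ∈ C → 0 ≤ x ∧ x ≤ 1 ∧ 0 ≤ y ∧ y ≤ 1
  chain : ∀ x y x' y' : ℝ, (x, y) ∈ C → (x', y') ∈ C → x + y ≤ x' + y' → x ≤ x' ∧ y ≤ y'
  ex : ∀ s : ℝ, 0 ≤ s → s ≤ 2 → ∃ x y : ℝ, (x, y) ∈ C ∧ x + y = s

lemma closure_Sm_compl : closure Smᶜ = {p : ℝ × ℝ | 1 ≤ p.1 + p.2} := by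
  apply Set.Subset.antisymm
  · apply closure_minimal
    · intro p hp
      simp only [Sm, Set.mem_compl_iff, Set.mem_ofPred_eq, not_le] at hp ⊢
      exact hp.le
    · exact isClosed_le continuous_const (by fun_prop)
  · intro p hp
    rw [Set.mem_ofPred_eq] at hp
    rw [Metric.mem_closure_iff]
    intro e he
    refine ⟨(p.1 + e / 2, p.2), ?_, ?_⟩
    · simp only [Sm, Set.mem_compl_iff, Set.mem_ofPred_eq, not_le]
      linarith
    · rw [Prod.dist_eq, Real.dist_eq, Real.dist_eq]
      simp only [max_lt_iff]
      constructor
      · rw [abs_lt]; constructor <;> linarith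
      · simpa using he

lemma mem_Wset {a b x y : ℝ} {C : Set (ℝ × ℝ)} :
    (x, y) ∈ Wset a b C ↔
      (x + y ≤ 1 ∧ ∃ u v, (u, v) ∈ C ∧ x = a * u ∧ y = b * v) ∨
      (1 ≤ x + y ∧ ∃ u v, (u, v) ∈ C ∧ x = b * u + 1 - b ∧ y = a * v + 1 - a) := by
  unfold Wset
  rw [closure_Sm_compl]
  simp only [Sm, Wm, Wp, Set.mem_union, Set.mem_inter_iff, Set.mem_ofPred_eq, Set.mem_image,
    Prod.exists, Prod.mk.injEq]
  constructor
  · rintro (⟨h, u, v, h1, h2, h3⟩ | ⟨h, u, v, h1, h2, h3⟩)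
    · exact Or.inl ⟨h, u, v, h1, h2.symm, h3.symm⟩
    · exact Or.inr ⟨h, u, v, h1, h2.symm, h3.symm⟩
  · rintro (⟨h, u, v, h1, h2, h3⟩ | ⟨h, u, v, h1, h2, h3⟩)
    · exact Or.inl ⟨h, u, v, h1, h2.symm, h3.symm⟩
    · exact Or.inr ⟨h, u, v, h1, h2.symm, h3.symm⟩

lemma Wset_symm {a b : ℝ} {C : Set (ℝ × ℝ)} (hC : RSymm C) : RSymm (Wset a b C) := by
  intro x y h
  rw [mem_Wset] at h ⊢
  rcases h with ⟨h, u, v, h1, h2, h3⟩ | ⟨h, u, v, h1, h2, h3⟩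
  · exact Or.inr ⟨by linarith, 1 - v, 1 - u, hC _ _ h1, by rw [h3]; ring, by rw [h2]; ring⟩
  · exact Or.inl ⟨by linarith, 1 - v, 1 - u, hC _ _ h1, by rw [h3]; ring, by rw [h2]; ring⟩

lemma Wset_low {a b x y : ℝ} {C : Set (ℝ × ℝ)} (hC : RSymm C) (h : (x, y) ∈ Wset a b C)
    (hs : x + y ≤ 1) : ∃ u v, (u, v) ∈ C ∧ x = a * u ∧ y = b * v := by
  rcases mem_Wset.1 h with ⟨_, h⟩ | ⟨h, u, v, h1, h2, h3⟩
  · exact h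
  · have hy : y = 1 - x := by linarith
    exact ⟨1 - v, 1 - u, hC _ _ h1, by linarith, by linarith⟩

lemma Wset_mono (a b : ℝ) : Monotone (Wset a b) := by
  intro C D h
  exact Set.union_subset_union (Set.inter_subset_inter_right _ (Set.image_mono h))
    (Set.inter_subset_inter_right _ (Set.image_mono h))

lemma Wset_box {a b : ℝ} (ha : a ∈ Set.Ioo (0:ℝ) 1) (hb : b ∈ Set.Ioo (0:ℝ) 1)
    {C : Set (ℝ × ℝ)} (hC : C ⊆ Set.Icc (0:ℝ) 1 ×ˢ Set.Icc (0:ℝ) 1) :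
    Wset a b C ⊆ Set.Icc (0:ℝ) 1 ×ˢ Set.Icc (0:ℝ) 1 := by
  rintro ⟨x, y⟩ h
  obtain ⟨ha0, ha1⟩ := ha
  obtain ⟨hb0, hb1⟩ := hb
  rcases mem_Wset.1 h with ⟨_, u, v, h1, h2, h3⟩ | ⟨h, u, v, h1, h2, h3⟩
  all_goals
    have := hC h1
    simp only [Set.mem_prod, Set.mem_Icc] at this ⊢
    obtain ⟨⟨hu0, hu1⟩, hv0, hv1⟩ := this
    subst h2 h3
    refine ⟨⟨?_, ?_⟩, ?_, ?_⟩ <;> nlinarith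

lemma RCurve.ivt {C : Set (ℝ × ℝ)} (hC : RCurve C) {a b s : ℝ} (ha0 : 0 ≤ a) (hb0 : 0 ≤ b)
    (hs0 : 0 ≤ s) (hs1 : s ≤ a + b) : ∃ x y : ℝ, (x, y) ∈ C ∧ a * x + b * y = s := by
  have := hC.ex
  choose! f g hf hfg using this
  have hfl : ∀ s t : ℝ, 0 ≤ s → t ≤ 2 → s ≤ t → f s ≤ f t ∧ g s ≤ g t := by
    intro s t h1 h2 h3
    apply hC.chain _ _ _ _ (hf s h1 (by linarith)) (hf t (by linarith) h2)
    rw [hfg s h1 (by linarith), hfg t (by linarith) h2]; exact h3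
  have hfc : LipschitzOnWith 1 f (Set.Icc 0 2) := by
    apply LipschitzOnWith.of_dist_le_mul
    intro s hs t ht
    simp only [Real.dist_eq, NNReal.coe_one, one_mul]
    have e1 := hfg s hs.1 hs.2
    have e2 := hfg t ht.1 ht.2
    rcases le_total s t with h | h
    · have := hfl s t hs.1 ht.2 h
      rw [abs_of_nonpos (by linarith), abs_of_nonpos (by linarith)]
      linarith
    · have := hfl t s ht.1 hs.2 h
      rw [abs_of_nonneg (by linarith), abs_of_nonneg (by linarith)]
      linarith
  have hc : ContinuousOn (fun t => a * f t + b * (t - f t)) (Set.Icc 0 2) := by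
    have := hfc.continuousOn
    fun_prop
  have h0 := hf 0 (by norm_num) (by norm_num)
  have h2 := hf 2 (by norm_num) (by norm_num)
  have e0 := hfg 0 (by norm_num) (by norm_num)
  have e2 := hfg 2 (by norm_num) (by norm_num)
  have b0 := hC.box _ _ h0
  have b2 := hC.box _ _ h2
  have f0 : f 0 = 0 := by linarith
  have f2 : f 2 = 1 := by linarith
  have := intermediate_value_Icc (by norm_num : (0:ℝ) ≤ 2) hc
  have hm : s ∈ Set.Icc (a * f 0 + b * (0 - f 0)) (a * f 2 + b * (2 - f 2)) := by
    rw [f0, f2]; constructor <;> linarith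
  obtain ⟨t, ht, hts⟩ := this hm
  simp only at hts
  have et := hfg t ht.1 ht.2
  have : g t = t - f t := by linarith
  exact ⟨f t, g t, hf t ht.1 ht.2, by rw [this]; exact hts⟩

lemma RCurve.Wset {a b : ℝ} (ha : a ∈ Set.Ioo (0:ℝ) 1) (hb : b ∈ Set.Ioo (0:ℝ) 1)
    (hab : 1 ≤ a + b) {C : Set (ℝ × ℝ)} (hC : RCurve C) : RCurve (Wset a b C) := by
  have ha0 := ha.1
  have hb0 := hb.1
  have hsym := Wset_symm (a := a) (b := b) hC.symm
  have hlow : ∀ x y x' y' : ℝ, (x, y) ∈ _root_.Wset a b C → (x', y') ∈ _root_.Wset a b C →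
      x' + y' ≤ 1 → x + y ≤ x' + y' → x ≤ x' ∧ y ≤ y' := by
    intro x y x' y' h h' h1 h2
    obtain ⟨u, v, hu, rfl, rfl⟩ := Wset_low hC.symm h (by linarith)
    obtain ⟨u', v', hu', rfl, rfl⟩ := Wset_low hC.symm h' (by linarith)
    rcases le_total (u + v) (u' + v') with hh | hh
    · obtain ⟨k1, k2⟩ := hC.chain _ _ _ _ hu hu' hh
      constructor <;> gcongr
    · obtain ⟨k1, k2⟩ := hC.chain _ _ _ _ hu' hu hh
      have k3 := mul_le_mul_of_nonneg_left k1 ha0.le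
      have k4 := mul_le_mul_of_nonneg_left k2 hb0.le
      constructor <;> linarith
  have hhigh : ∀ x y x' y' : ℝ, (x, y) ∈ _root_.Wset a b C → (x', y') ∈ _root_.Wset a b C →
      1 ≤ x + y → x + y ≤ x' + y' → x ≤ x' ∧ y ≤ y' := by
    intro x y x' y' h h' h1 h2
    have := hlow _ _ _ _ (hsym _ _ h') (hsym _ _ h) (by linarith) (by linarith)
    constructor <;> linarith [this.1, this.2]
  have hexl : ∀ s : ℝ, 0 ≤ s → s ≤ 1 → ∃ x y : ℝ, (x, y) ∈ _root_.Wset a b C ∧ x + y = s := by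
    intro s hs0 hs1
    obtain ⟨x, y, h, e⟩ := hC.ivt ha0.le hb0.le hs0 (by linarith)
    exact ⟨a * x, b * y, mem_Wset.2 (Or.inl ⟨by linarith, x, y, h, rfl, rfl⟩), e⟩
  refine ⟨hsym, ?_, ?_, ?_⟩
  · intro x y h
    have := Wset_box ha hb (C := C) (fun p hp => by
      have := hC.box p.1 p.2 hp
      exact ⟨⟨this.1, this.2.1⟩, this.2.2.1, this.2.2.2⟩) h
    exact ⟨this.1.1, this.1.2, this.2.1, this.2.2⟩
  · intro x y x' y' h h' hs
    rcases le_total (x' + y') 1 with h1 | h1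
    · exact hlow _ _ _ _ h h' h1 hs
    rcases le_total 1 (x + y) with h2 | h2
    · exact hhigh _ _ _ _ h h' h2 hs
    obtain ⟨u, v, huv, e⟩ := hexl 1 (by norm_num) le_rfl
    have k1 := hlow _ _ _ _ h huv (by linarith) (by linarith)
    have k2 := hhigh _ _ _ _ huv h' (by linarith) (by linarith)
    exact ⟨k1.1.trans k2.1, k1.2.trans k2.2⟩
  · intro s h0 h2
    rcases le_total s 1 with h | h
    · exact hexl s h0 h
    · obtain ⟨x, y, hxy, e⟩ := hexl (2 - s) (by linarith) (by linarith)
      exact ⟨_, _, hsym _ _ hxy, by linarith⟩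

lemma width_step {a b d : ℝ} (ha : a ∈ Set.Ioo (0:ℝ) 1) (hb : b ∈ Set.Ioo (0:ℝ) 1)
    (hba : b ≤ a) {C G : Set (ℝ × ℝ)} (hG : RCurve G) (hC : RSymm C)
    (hbox : C ⊆ Set.Icc (0:ℝ) 1 ×ˢ Set.Icc (0:ℝ) 1)
    (hw : ∀ x y x' y' : ℝ, (x, y) ∈ C → (x', y') ∈ G → x + y = x' + y' → |x - x'| ≤ d) :
    ∀ x y x' y' : ℝ, (x, y) ∈ Wset a b C → (x', y') ∈ Wset a b G → x + y = x' + y' →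
      |x - x'| ≤ a * d := by
  have ha0 := ha.1
  have hb0 := hb.1
  have hlow : ∀ x y x' y' : ℝ, (x, y) ∈ Wset a b C → (x', y') ∈ Wset a b G → x + y ≤ 1 →
      x + y = x' + y' → |x - x'| ≤ a * d := by
    intro x y x' y' h h' h1 h2
    obtain ⟨u, v, hu, rfl, rfl⟩ := Wset_low hC h h1
    obtain ⟨u', v', hu', rfl, rfl⟩ := Wset_low hG.symm h' (by linarith)
    obtain ⟨⟨hu0, hu1⟩, hv0, hv1⟩ := hbox hu
    simp only at hu0 hu1 hv0 hv1
    obtain ⟨p, q, hpq, e⟩ := hG.ex (u + v) (by linarith) (by linarith)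
    have hd := hw _ _ _ _ hu hpq e.symm
    rw [← mul_sub, abs_mul, abs_of_pos ha0]
    apply mul_le_mul_of_nonneg_left _ ha0.le
    rw [abs_le] at hd
    have key : a * (u - u') = b * (v' - v) := by linarith
    rcases le_total u' u with hh | hh
    · have : u - u' ≤ v' - v := by
        by_contra hcon
        push Not at hcon
        nlinarith
      have := hG.chain _ _ _ _ hpq hu' (by linarith)
      rw [abs_of_nonneg (by linarith)]
      linarith
    · have : u' - u ≤ v - v' := by
        by_contra hcon
        push Not at hcon
        nlinarith
      have := hG.chain _ _ _ _ hu' hpq (by linarith)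
      rw [abs_of_nonpos (by linarith)]
      linarith
  intro x y x' y' h h' e
  rcases le_total (x + y) 1 with h1 | h1
  · exact hlow _ _ _ _ h h' h1 e
  · have := hlow _ _ _ _ (Wset_symm hC _ _ h) (Wset_symm hG.symm _ _ h') (by linarith) (by linarith)
    have e2 : x - x' = (1 - y) - (1 - y') := by linarith
    rw [e2]; exact this

lemma diag_curve : RCurve {p : ℝ × ℝ | 0 ≤ p.1 ∧ p.1 ≤ 1 ∧ p.2 = p.1} := by
  refine ⟨?_, ?_, ?_, ?_⟩
  · rintro x y ⟨h1, h2, h3⟩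
    simp only [Set.mem_ofPred_eq] at *
    refine ⟨?_, ?_, ?_⟩ <;> linarith
  · rintro x y ⟨h1, h2, h3⟩
    simp only at *
    refine ⟨?_, ?_, ?_, ?_⟩ <;> linarith
  · rintro x y x' y' ⟨h1, h2, h3⟩ ⟨h1', h2', h3'⟩ h
    simp only at *
    constructor <;> linarith
  · intro s h0 h2
    exact ⟨s / 2, s / 2, ⟨by simp only; linarith, by simp only; linarith, rfl⟩, by ring⟩

section
variable {a b : ℝ}

lemma box_symm : RSymm (Set.Icc (0:ℝ) 1 ×ˢ Set.Icc (0:ℝ) 1) := by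
  rintro x y ⟨⟨h1, h2⟩, h3, h4⟩
  simp only at h1 h2 h3 h4
  refine ⟨⟨?_, ?_⟩, ?_, ?_⟩ <;> simp only <;> linarith

lemma iter_facts (ha : a ∈ Set.Ioo (0:ℝ) 1) (hb : b ∈ Set.Ioo (0:ℝ) 1)
    (hba : b ≤ a) (hab : 1 ≤ a + b) (k : ℕ) :
    ∃ G : Set (ℝ × ℝ), RCurve G ∧
      G ⊆ (Wset a b)^[k] (Set.Icc (0:ℝ) 1 ×ˢ Set.Icc (0:ℝ) 1) ∧
      RSymm ((Wset a b)^[k] (Set.Icc (0:ℝ) 1 ×ˢ Set.Icc (0:ℝ) 1)) ∧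
      (Wset a b)^[k] (Set.Icc (0:ℝ) 1 ×ˢ Set.Icc (0:ℝ) 1) ⊆ Set.Icc (0:ℝ) 1 ×ˢ Set.Icc (0:ℝ) 1 ∧
      IsCompact ((Wset a b)^[k] (Set.Icc (0:ℝ) 1 ×ˢ Set.Icc (0:ℝ) 1)) ∧
      (Wset a b)^[k+1] (Set.Icc (0:ℝ) 1 ×ˢ Set.Icc (0:ℝ) 1) ⊆
        (Wset a b)^[k] (Set.Icc (0:ℝ) 1 ×ˢ Set.Icc (0:ℝ) 1) ∧
      ∀ x y x' y' : ℝ, (x, y) ∈ (Wset a b)^[k] (Set.Icc (0:ℝ) 1 ×ˢ Set.Icc (0:ℝ) 1) →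
        (x', y') ∈ G → x + y = x' + y' → |x - x'| ≤ a ^ k := by
  induction k with
  | zero =>
    refine ⟨_, diag_curve, ?_, box_symm, subset_rfl, isCompact_Icc.prod isCompact_Icc,
      Wset_box ha hb subset_rfl, ?_⟩
    · rintro ⟨x, y⟩ ⟨h1, h2, h3⟩
      simp only at h1 h2 h3
      subst h3
      exact ⟨⟨h1, h2⟩, h1, h2⟩
    · rintro x y x' y' ⟨⟨h1, h2⟩, h3, h4⟩ ⟨h5, h6, h7⟩ h
      simp only at *
      rw [pow_zero, abs_le]
      constructor <;> linarith
  | succ k ih =>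
    obtain ⟨G, h1, h2, h3, h4, h5, h6, h7⟩ := ih
    rw [Function.iterate_succ_apply' _ (k+1)]
    rw [Function.iterate_succ_apply'] at h6 ⊢
    refine ⟨Wset a b G, h1.Wset ha hb hab, Wset_mono a b h2, Wset_symm h3, Wset_box ha hb h4,
      ?_, Wset_mono a b h6, ?_⟩
    · unfold Wset
      apply IsCompact.union
      · apply IsCompact.inter_left
        · exact h5.image (by unfold Wm; fun_prop)
        · exact isClosed_le (by fun_prop) continuous_const
      · apply IsCompact.inter_left
        · exact h5.image (by unfold Wp; fun_prop)
        · exact isClosed_closure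
    · rw [pow_succ']
      exact width_step ha hb hba h1 h3 h4 h7

lemma repeller_curve (ha : a ∈ Set.Ioo (0:ℝ) 1) (hb : b ∈ Set.Ioo (0:ℝ) 1)
    (hba : b ≤ a) (hab : 1 ≤ a + b) : RCurve (repeller a b) := by
  have H := iter_facts ha hb hba hab
  have hlim : Filter.Tendsto (fun k : ℕ => 2 * a ^ k) Filter.atTop (nhds 0) := by
    simpa using (tendsto_pow_atTop_nhds_zero_of_lt_one ha.1.le ha.2).const_mul 2
  have hbox : ∀ x y : ℝ, (x, y) ∈ repeller a b → 0 ≤ x ∧ x ≤ 1 ∧ 0 ≤ y ∧ y ≤ 1 := by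
    intro x y h
    have := Set.mem_iInter.1 h 0
    exact ⟨this.1.1, this.1.2, this.2.1, this.2.2⟩
  refine ⟨?_, hbox, ?_, ?_⟩
  · intro x y h
    refine Set.mem_iInter.2 fun k => ?_
    obtain ⟨G, h1, h2, h3, h4, h5, h6, h7⟩ := H k
    exact h3 _ _ (Set.mem_iInter.1 h k)
  · intro x y x' y' h h' hs
    have key : ∀ k : ℕ, x - x' ≤ 2 * a ^ k ∧ y - y' ≤ 2 * a ^ k := by
      intro k
      obtain ⟨G, h1, h2, h3, h4, h5, h6, h7⟩ := H k
      have b1 := hbox _ _ h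
      have b2 := hbox _ _ h'
      obtain ⟨p, q, hpq, e⟩ := h1.ex (x + y) (by linarith) (by linarith)
      obtain ⟨p', q', hpq', e'⟩ := h1.ex (x' + y') (by linarith) (by linarith)
      have c := h1.chain _ _ _ _ hpq hpq' (by linarith)
      have d := abs_le.1 (h7 _ _ _ _ (Set.mem_iInter.1 h k) hpq e.symm)
      have d' := abs_le.1 (h7 _ _ _ _ (Set.mem_iInter.1 h' k) hpq' e'.symm)
      constructor <;> linarith
    have k1 := ge_of_tendsto' hlim (fun k => (key k).1)
    have k2 := ge_of_tendsto' hlim (fun k => (key k).2)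
    constructor <;> linarith
  · intro s h0 h2
    have hcl : IsClosed {p : ℝ × ℝ | p.1 + p.2 = s} := isClosed_eq (by fun_prop) continuous_const
    have := IsCompact.nonempty_iInter_of_sequence_nonempty_isCompact_isClosed
      (fun k : ℕ => (Wset a b)^[k] (Set.Icc (0:ℝ) 1 ×ˢ Set.Icc (0:ℝ) 1) ∩ {p | p.1 + p.2 = s})
      (fun k => by
        obtain ⟨G, h1, h2, h3, h4, h5, h6, h7⟩ := H k
        exact Set.inter_subset_inter_left _ h6)
      (fun k => by
        obtain ⟨G, h1, h2, h3, h4, h5, h6, h7⟩ := H k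
        obtain ⟨x, y, h, e⟩ := h1.ex s (by assumption) (by assumption)
        exact ⟨(x, y), h2 h, e⟩)
      (by
        obtain ⟨G, h1, h2, h3, h4, h5, h6, h7⟩ := H 0
        exact h5.inter_right hcl)
      (fun k => by
        obtain ⟨G, h1, h2, h3, h4, h5, h6, h7⟩ := H k
        exact h5.isClosed.inter hcl)
    obtain ⟨⟨x, y⟩, h⟩ := this
    rw [Set.mem_iInter] at h
    exact ⟨x, y, Set.mem_iInter.2 fun k => (h k).1, (h 0).2⟩

lemma repeller_low (ha : a ∈ Set.Ioo (0:ℝ) 1) (hb : b ∈ Set.Ioo (0:ℝ) 1)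
    (hba : b ≤ a) (hab : 1 ≤ a + b) {x y : ℝ} (h : (x, y) ∈ repeller a b) (hs : x + y ≤ 1) :
    (x / a, y / b) ∈ repeller a b := by
  refine Set.mem_iInter.2 fun k => ?_
  obtain ⟨G, h1, h2, h3, h4, h5, h6, h7⟩ := iter_facts ha hb hba hab k
  have := Set.mem_iInter.1 h (k + 1)
  rw [Function.iterate_succ_apply'] at this
  obtain ⟨u, v, huv, rfl, rfl⟩ := Wset_low h3 this hs
  rw [mul_div_cancel_left₀ _ ha.1.ne', mul_div_cancel_left₀ _ hb.1.ne']
  exact huv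

lemma repeller_vert (ha : a ∈ Set.Ioo (0:ℝ) 1) (hb : b ∈ Set.Ioo (0:ℝ) 1)
    (hba : b ≤ a) (hab : 1 ≤ a + b) {x y y' : ℝ} (h : (x, y) ∈ repeller a b)
    (h' : (x, y') ∈ repeller a b) : y = y' := by
  have hR := repeller_curve ha hb hba hab
  have ha0 := ha.1
  have hb0 := hb.1
  have key : ∀ n : ℕ, ∀ x y y' : ℝ, (x, y) ∈ repeller a b → (x, y') ∈ repeller a b →
      y ≤ y' → y' - y ≤ a ^ n := by
    intro n
    induction n with
    | zero =>
      intro x y y' h h' _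
      have := hR.box _ _ h
      have := hR.box _ _ h'
      rw [pow_zero]; linarith
    | succ n ih =>
      intro x y y' h h' hy
      have hp : 0 < a ^ n := pow_pos ha0 n
      rcases le_or_gt (x + y') 1 with h1 | h1
      · have := ih _ _ _ (repeller_low ha hb hba hab h (by linarith))
          (repeller_low ha hb hba hab h' h1) (by gcongr)
        rw [← sub_div, div_le_iff₀ hb0] at this
        rw [pow_succ]
        nlinarith
      rcases le_or_gt 1 (x + y) with h2 | h2
      · have k1 := hR.symm _ _ (repeller_low ha hb hba hab (hR.symm _ _ h) (by linarith))
        have k2 := hR.symm _ _ (repeller_low ha hb hba hab (hR.symm _ _ h') (by linarith))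
        have := ih _ _ _ k1 k2 (by gcongr)
        have e : 1 - (1 - y') / a - (1 - (1 - y) / a) = (y' - y) / a := by ring
        rw [e, div_le_iff₀ ha0] at this
        rw [pow_succ]
        exact this
      · exfalso
        have k := hR.symm _ _ h
        rcases le_total (1 - y + (1 - x)) (x + y') with hh | hh
        · have := hR.chain _ _ _ _ k h' hh
          linarith
        · have := hR.chain _ _ _ _ h' k hh
          linarith
  have hlim := tendsto_pow_atTop_nhds_zero_of_lt_one ha.1.le ha.2
  rcases le_total y y' with hy | hy
  · have := ge_of_tendsto' hlim (fun n => key n _ _ _ h h' hy)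
    linarith
  · have := ge_of_tendsto' hlim (fun n => key n _ _ _ h' h hy)
    linarith

end

/-- For `a, b ∈ (0,1)` with `a ≥ b` and `a + b ≥ 1`, the repeller
`R = ⋂_k W^k([0,1]²)` is the graph of a continuous, strictly increasing function
`Φ : [0,1] → [0,1]` with `Φ(0) = 0`, `Φ(1) = 1` and `Φ(1 - Φ(x)) = 1 - x` for all
`x ∈ [0,1]`; in particular `R` is symmetric about the line `x + y = 1` and both
coordinate projections map `R` onto `[0,1]`. -/
theorem repeller_is_graph
    (a b : ℝ) (ha : a ∈ Set.Ioo (0:ℝ) 1) (hb : b ∈ Set.Ioo (0:ℝ) 1)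
    (hba : b ≤ a) (hab : 1 ≤ a + b) :
    ∃ Φ : ℝ → ℝ,
      ContinuousOn Φ (Set.Icc 0 1) ∧
      StrictMonoOn Φ (Set.Icc 0 1) ∧
      Set.MapsTo Φ (Set.Icc 0 1) (Set.Icc 0 1) ∧
      Φ 0 = 0 ∧ Φ 1 = 1 ∧
      (∀ x ∈ Set.Icc (0:ℝ) 1, Φ (1 - Φ x) = 1 - x) ∧
      repeller a b = {p : ℝ × ℝ | p.1 ∈ Set.Icc (0:ℝ) 1 ∧ p.2 = Φ p.1} ∧
      (∀ p ∈ repeller a b, (1 - p.2, 1 - p.1) ∈ repeller a b) ∧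
      Prod.fst '' repeller a b = Set.Icc 0 1 ∧
      Prod.snd '' repeller a b = Set.Icc 0 1 := by
  have hR := repeller_curve ha hb hba hab
  have hV : ∀ {x y y' : ℝ}, (x, y) ∈ repeller a b → (x, y') ∈ repeller a b → y = y' :=
    fun h h' => repeller_vert ha hb hba hab h h'
  have hX : ∀ x ∈ Set.Icc (0:ℝ) 1, ∃ y, (x, y) ∈ repeller a b := by
    intro x hx
    obtain ⟨u, v, h, e⟩ := hR.ivt (a := 1) (b := 0) (s := x) (by norm_num) le_rfl hx.1
      (by linarith [hx.2])
    have : u = x := by linarith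
    exact ⟨v, this ▸ h⟩
  choose! Φ hΦ using hX
  have hmem : ∀ x y : ℝ, (x, y) ∈ repeller a b → x ∈ Set.Icc (0:ℝ) 1 ∧ y = Φ x := by
    intro x y h
    have hb := hR.box _ _ h
    have hx : x ∈ Set.Icc (0:ℝ) 1 := ⟨hb.1, hb.2.1⟩
    exact ⟨hx, hV h (hΦ x hx)⟩
  have hmaps : Set.MapsTo Φ (Set.Icc 0 1) (Set.Icc 0 1) := by
    intro x hx
    have := hR.box _ _ (hΦ x hx)
    exact ⟨this.2.2.1, this.2.2.2⟩
  have hinv : ∀ x ∈ Set.Icc (0:ℝ) 1, Φ (1 - Φ x) = 1 - x := by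
    intro x hx
    exact (hmem _ _ (hR.symm _ _ (hΦ x hx))).2.symm
  have hinj : ∀ x ∈ Set.Icc (0:ℝ) 1, ∀ y ∈ Set.Icc (0:ℝ) 1, Φ x = Φ y → x = y := by
    intro x hx y hy h
    have h1 := hinv x hx
    have h2 := hinv y hy
    rw [h] at h1
    linarith
  have hmono : StrictMonoOn Φ (Set.Icc 0 1) := by
    intro x hx y hy hxy
    rcases le_total (x + Φ x) (y + Φ y) with h | h
    · have := (hR.chain _ _ _ _ (hΦ x hx) (hΦ y hy) h).2
      refine lt_of_le_of_ne this fun e => hxy.ne (hinj x hx y hy e)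
    · have := (hR.chain _ _ _ _ (hΦ y hy) (hΦ x hx) h).1
      linarith
  have hsurj : ∀ y ∈ Set.Icc (0:ℝ) 1, ∃ x ∈ Set.Icc (0:ℝ) 1, Φ x = y := by
    intro y hy
    have hy' : 1 - y ∈ Set.Icc (0:ℝ) 1 := ⟨by linarith [hy.2], by linarith [hy.1]⟩
    have := hmaps hy'
    exact ⟨1 - Φ (1 - y), ⟨by linarith [this.2], by linarith [this.1]⟩, by
      rw [hinv _ hy']; ring⟩
  have m0 : (0:ℝ) ∈ Set.Icc (0:ℝ) 1 := by constructor <;> norm_num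
  have m1 : (1:ℝ) ∈ Set.Icc (0:ℝ) 1 := by constructor <;> norm_num
  refine ⟨Φ, ?_, hmono, hmaps, ?_, ?_, hinv, ?_, ?_, ?_, ?_⟩
  · have hc : Continuous (hmaps.restrict Φ _ _) := by
      apply Monotone.continuous_of_surjective
      · intro x y hxy
        exact hmono.monotoneOn x.2 y.2 hxy
      · intro y
        obtain ⟨x, hx, e⟩ := hsurj y y.2
        exact ⟨⟨x, hx⟩, Subtype.ext e⟩
    rw [continuousOn_iff_continuous_restrict]
    exact continuous_subtype_val.comp hc
  · obtain ⟨x, hx, e⟩ := hsurj 0 m0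
    have := hmono.monotoneOn m0 hx hx.1
    have := (hmaps m0).1
    linarith
  · obtain ⟨x, hx, e⟩ := hsurj 1 m1
    have := hmono.monotoneOn hx m1 hx.2
    have := (hmaps m1).2
    linarith
  · ext ⟨x, y⟩
    constructor
    · exact hmem x y
    · rintro ⟨h1, h2⟩
      simp only at h1 h2
      rw [h2]
      exact hΦ x h1
  · rintro ⟨x, y⟩ h
    exact hR.symm _ _ h
  · ext x
    constructor
    · rintro ⟨⟨u, v⟩, h, rfl⟩
      exact (hmem _ _ h).1
    · intro hx
      exact ⟨_, hΦ x hx, rfl⟩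
  · ext y
    constructor
    · rintro ⟨⟨u, v⟩, h, rfl⟩
      have := hR.box _ _ h
      exact ⟨this.2.2.1, this.2.2.2⟩
    · intro hy
      obtain ⟨x, hx, e⟩ := hsurj y hy
      exact ⟨_, hΦ x hx, e⟩
end

section
/- Let a, b ∈ (0,1) with a ≥ b and a + b ≥ 1. Consider the iterated function system F = ([0,1]; f_1(x) = a x, f_2(x) = b x + 1 - b) with coding map π_F, and for p ∈ [1-b, a] give F the mask M^{(p)} = {M_1 = [0,p], M_2 = (p,1]}, with associated masked section τ_F^{(p)} : [0,1] → {1,2}^ℕ. Consider also the iterated function system G = ([0,1]; g_1(x) = b x, g_2(x) = a x + 1 - a) with coding map π_G, and give G the mask M^{(1-p)} = {[0,1-p], (1-p,1]}, with associated masked section τ_G^{(1-p)}. Then there exists p* ∈ [1-b, a] such that the fractal transformation T_FG = π_G ∘ τ_F^{(p*)} : [0,1] → [0,1] is a homeomorphism, and its inverse is T_GF = π_F ∘ τ_G^{(1-p*)} : [0,1] → [0,1]. -/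
/-- `seqComp f σ k = f (σ 0) ∘ f (σ 1) ∘ ⋯ ∘ f (σ (k-1))`. -/
def seqComp {X : Type*} {N : ℕ} (f : Fin N → X → X) (σ : ℕ → Fin N) : ℕ → X → X
  | 0 => id
  | k + 1 => seqComp f σ k ∘ f (σ k)

/-- The masked dynamical system on `[0,1]` for the IFS `(c x, d x + 1 - d)` with mask
`M₁ = [0,p]`, `M₂ = (p,1]`: it applies the inverse of the first map on `M₁} and the
inverse of the second map on `M₂`. -/
noncomputable def maskedT (c d p : ℝ) (x : ℝ) : ℝ :=
  if x ≤ p then x / c else (x - (1 - d)) / d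

/-- The masked section (itinerary map) for the IFS `(c x, d x + 1 - d)` with the mask
`M₁ = [0,p]`, `M₂ = (p,1]`: symbol `0` when the orbit point lies in `M₁`, symbol `1`
otherwise. -/
noncomputable def itin (c d p : ℝ) (x : ℝ) : ℕ → Fin 2 :=
  fun k => if (maskedT c d p)^[k] x ≤ p then 0 else 1

section Helpers

open Set Filter Topology

/-- Points of the plane surviving `n` steps of the symmetric expanding dynamics. -/
def Cn (a b : ℝ) : ℕ → ℝ → ℝ → Prop
  | 0 => fun x y => (0 ≤ x ∧ x ≤ 1) ∧ (0 ≤ y ∧ y ≤ 1)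
  | n + 1 => fun x y => ((0 ≤ x ∧ x ≤ 1) ∧ (0 ≤ y ∧ y ≤ 1)) ∧
      ((x ≤ y ∧ Cn a b n (x / a) ((y - (1 - b)) / b)) ∨
       (y ≤ x ∧ Cn a b n ((x - (1 - b)) / b) (y / a)))

def Cinf (a b x y : ℝ) : Prop := ∀ n, Cn a b n x y

lemma Cn_box {a b : ℝ} {n : ℕ} {x y : ℝ} (h : Cn a b n x y) :
    (0 ≤ x ∧ x ≤ 1) ∧ (0 ≤ y ∧ y ≤ 1) := by
  cases n with
  | zero => exact h
  | succ n => exact h.1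

lemma Cn_symm {a b : ℝ} (n : ℕ) : ∀ {x y : ℝ}, Cn a b n x y → Cn a b n y x := by
  induction n with
  | zero => intro x y h; exact ⟨h.2, h.1⟩
  | succ n ih =>
    intro x y h
    refine ⟨⟨h.1.2, h.1.1⟩, ?_⟩
    rcases h.2 with ⟨h1, h2⟩ | ⟨h1, h2⟩
    · exact Or.inr ⟨h1, ih h2⟩
    · exact Or.inl ⟨h1, ih h2⟩

lemma Cn_anti {a b : ℝ} (n : ℕ) : ∀ {x y : ℝ}, Cn a b (n + 1) x y → Cn a b n x y := by
  induction n with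
  | zero => intro x y h; exact h.1
  | succ n ih =>
    intro x y h
    refine ⟨h.1, ?_⟩
    rcases h.2 with ⟨h1, h2⟩ | ⟨h1, h2⟩
    · exact Or.inl ⟨h1, ih h2⟩
    · exact Or.inr ⟨h1, ih h2⟩

lemma Cn_step {a b : ℝ} {n : ℕ} {x y : ℝ} (h : Cn a b (n + 1) x y) (hxy : x ≤ y) :
    Cn a b n (x / a) ((y - (1 - b)) / b) := by
  rcases h.2 with ⟨h1, h2⟩ | ⟨h1, h2⟩
  · exact h2
  · have : x = y := le_antisymm hxy h1
    subst this
    exact Cn_symm n h2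

lemma Cn_closed {a b : ℝ} (n : ℕ) : IsClosed {z : ℝ × ℝ | Cn a b n z.1 z.2} := by
  have box : IsClosed {z : ℝ × ℝ | (0 ≤ z.1 ∧ z.1 ≤ 1) ∧ (0 ≤ z.2 ∧ z.2 ≤ 1)} := by
    refine IsClosed.and (IsClosed.and ?_ ?_) (IsClosed.and ?_ ?_) <;>
      exact isClosed_le (by fun_prop) (by fun_prop)
  induction n with
  | zero => exact box
  | succ n ih =>
    refine IsClosed.and box (IsClosed.union (IsClosed.and ?_ ?_) (IsClosed.and ?_ ?_))
    · exact isClosed_le (by fun_prop) (by fun_prop)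
    · exact ih.preimage (f := fun z : ℝ × ℝ => (z.1 / a, (z.2 - (1 - b)) / b)) (by fun_prop)
    · exact isClosed_le (by fun_prop) (by fun_prop)
    · exact ih.preimage (f := fun z : ℝ × ℝ => ((z.1 - (1 - b)) / b, z.2 / a)) (by fun_prop)

section
variable {a b : ℝ}

lemma Cinf_symm {x y : ℝ} (h : Cinf a b x y) : Cinf a b y x := fun n => Cn_symm n (h n)

lemma Cinf_step0 {x y : ℝ} (h : Cinf a b x y) (hxy : x ≤ y) :
    Cinf a b (x / a) ((y - (1 - b)) / b) := fun n => Cn_step (h (n + 1)) hxy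

lemma Cinf_step1 {x y : ℝ} (h : Cinf a b x y) (hxy : y ≤ x) :
    Cinf a b ((x - (1 - b)) / b) (y / a) := Cinf_symm (Cinf_step0 (Cinf_symm h) hxy)

lemma gapA (ha : 0 < a) {x x' t : ℝ} (h : x + t ≤ x') : x / a + t / a ≤ x' / a := by
  rw [← add_div]; gcongr

lemma gapB (hb : 0 < b) (hba : b ≤ a) {x x' t : ℝ} (ht : 0 ≤ t) (h : x + t ≤ x') :
    (x - (1 - b)) / b + t / a ≤ (x' - (1 - b)) / b := by
  have h1 : t / a ≤ t / b := by gcongr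
  have h2 : (x - (1 - b)) / b + t / b ≤ (x' - (1 - b)) / b := by
    rw [← add_div]; gcongr; linarith
  linarith

lemma Cn_gap (ha : 0 < a) (hb : 0 < b) (hba : b ≤ a) (n : ℕ) :
    ∀ {x y x' y' t : ℝ}, 0 ≤ t → Cn a b n x y → Cn a b n x' y' → x + t ≤ x' → y + t ≤ y' →
      t ≤ a ^ n := by
  induction n with
  | zero =>
    intro x y x' y' t ht h h' h1 h2
    have := h.1.1; have := h'.1.2
    simp; linarith
  | succ n ih =>
    intro x y x' y' t ht h h' h1 h2
    have ht' : 0 ≤ t / a := by positivity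
    have key : t / a ≤ a ^ n := by
      rcases h.2 with ⟨h3, h4⟩ | ⟨h3, h4⟩ <;> rcases h'.2 with ⟨h5, h6⟩ | ⟨h5, h6⟩
      · exact ih ht' h4 h6 (gapA ha h1) (gapB hb hba ht h2)
      · exact ih ht' h4 (Cn_symm n h6) (gapA ha (by linarith)) (gapB hb hba ht (by linarith))
      · exact ih ht' h4 (Cn_symm n h6) (gapB hb hba ht (by linarith)) (gapA ha (by linarith))
      · exact ih ht' h4 h6 (gapB hb hba ht h1) (gapA ha h2)
    rw [div_le_iff₀ ha] at key
    rw [pow_succ]; exact key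

lemma small_of_pow (ha : 0 < a) (ha1 : a < 1) {t : ℝ} (h : ∀ n : ℕ, t ≤ a ^ n) : t ≤ 0 :=
  ge_of_tendsto' (tendsto_pow_atTop_nhds_zero_of_lt_one ha.le ha1) h

lemma Cinf_antichain (ha : 0 < a) (ha1 : a < 1) (hb : 0 < b) (hba : b ≤ a)
    {x y x' y' : ℝ} (h : Cinf a b x y) (h' : Cinf a b x' y') (hx : x < x') (hy : y < y') :
    False := by
  have h0 : 0 < min (x' - x) (y' - y) := lt_min (by linarith) (by linarith)
  have := small_of_pow ha ha1 (t := min (x' - x) (y' - y)) (fun n =>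
    Cn_gap ha hb hba n h0.le (h n) (h' n)
      (by linarith [min_le_left (x' - x) (y' - y)]) (by linarith [min_le_right (x' - x) (y' - y)]))
  linarith

lemma Cinf_vgap (ha : 0 < a) (ha1 : a < 1) (hb : 0 < b) (hba : b ≤ a) (n : ℕ) :
    ∀ {x y y' t : ℝ}, 0 ≤ t → Cinf a b x y → Cinf a b x y' → y + t ≤ y' → t ≤ a ^ n := by
  induction n with
  | zero =>
    intro x y y' t ht h h' h1
    have := (h 0).2.1; have := (h' 0).2.2
    simp; linarith
  | succ n ih =>
    intro x y y' t ht h h' h1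
    have ht' : 0 ≤ t / a := by positivity
    have key : t / a ≤ a ^ n := by
      rcases le_or_gt x y with hxy | hxy
      · exact ih ht' (Cinf_step0 h hxy) (Cinf_step0 h' (by linarith)) (gapB hb hba ht h1)
      · rcases le_or_gt y' x with hxy' | hxy'
        · exact ih ht' (Cinf_step1 h hxy.le) (Cinf_step1 h' hxy') (gapA ha h1)
        · exact (Cinf_antichain ha ha1 hb hba (Cinf_symm h) h' hxy hxy').elim
    rw [div_le_iff₀ ha] at key
    rw [pow_succ]; exact key

lemma Cinf_unique (ha : 0 < a) (ha1 : a < 1) (hb : 0 < b) (hba : b ≤ a)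
    {x y y' : ℝ} (h : Cinf a b x y) (h' : Cinf a b x y') : y = y' := by
  have aux : ∀ {y y' : ℝ}, Cinf a b x y → Cinf a b x y' → y' ≤ y := by
    intro y y' h h'
    by_contra hc
    push Not at hc
    have := small_of_pow ha ha1 (t := y' - y) (fun n =>
      Cinf_vgap ha ha1 hb hba n (by linarith) h h' (by linarith))
    linarith
  exact le_antisymm (aux h' h) (aux h h')

lemma Cinf_strict (ha : 0 < a) (ha1 : a < 1) (hb : 0 < b) (hba : b ≤ a)
    {x y x' y' : ℝ} (h : Cinf a b x y) (h' : Cinf a b x' y') (hx : x < x') : y' < y := by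
  by_contra hc
  push Not at hc
  rcases hc.lt_or_eq with hc | hc
  · exact Cinf_antichain ha ha1 hb hba h h' hx hc
  · subst hc
    exact hx.ne (Cinf_unique ha ha1 hb hba (Cinf_symm h) (Cinf_symm h'))

/-- Approximating involutions. -/
lemma exists_R (ha : 0 < a) (hb : 0 < b) (hb1 : b < 1) (hab : 1 ≤ a + b) (n : ℕ) :
    ∃ R : ℝ → ℝ, Continuous R ∧ Antitone R ∧ (∀ x, R (R x) = x) ∧ R 0 = 1 ∧
      (∀ x, 0 ≤ x → x ≤ 1 → Cn a b n x (R x)) ∧ ∃ p, Cn a b n p p := by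
  induction n with
  | zero =>
    refine ⟨fun x => 1 - x, by fun_prop, fun x y h => sub_le_sub_left h 1, fun x => by ring, by simp,
      fun x h0 h1 => ⟨⟨h0, h1⟩, by linarith, by linarith⟩, 1/2, ?_⟩
    norm_num [Cn]
  | succ n ih =>
    obtain ⟨R, hc, hm, hi, h01, hR, -⟩ := ih
    have h10 : R 1 = 0 := by rw [← h01, hi]
    have hivt := intermediate_value_Icc' (f := fun x => b * R (x / a) + (1 - b) - x) ha.le
      (by fun_prop)
    obtain ⟨p, ⟨hp0, hpa⟩, hp⟩ := hivt (show (0:ℝ) ∈ _ by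
      simp only [zero_div, div_self ha.ne', h01, h10]
      constructor <;> linarith)
    have hp' : b * R (p / a) + (1 - b) = p := by
      have : b * R (p / a) + (1 - b) - p = 0 := hp
      linarith
    have hpa1 : p / a ≤ 1 := (div_le_one ha).2 hpa
    have hRp : 0 ≤ R (p / a) := by rw [← h10]; exact hm hpa1
    have hpb : 1 - b ≤ p := by nlinarith
    have hRp2 : R (p / a) = (p - (1 - b)) / b := by
      rw [eq_div_iff hb.ne']; linarith
    have hp2 : a * R ((p - (1 - b)) / b) = p := by
      rw [← hRp2, hi]; field_simp
    set R' : ℝ → ℝ := fun x => if x ≤ p then b * R (x / a) + (1 - b)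
      else a * R ((x - (1 - b)) / b) with hR'
    have e0 : ∀ x, x ≤ p → R' x = b * R (x / a) + (1 - b) := fun x hx => by simp [hR', hx]
    have e1 : ∀ x, p ≤ x → R' x = a * R ((x - (1 - b)) / b) := fun x hx => by
      rcases hx.lt_or_eq with hx | hx
      · simp [hR', not_le.2 hx]
      · subst hx; rw [e0 _ le_rfl, hp', hp2]
    have m0 : ∀ x y, x ≤ y → b * R (y / a) + (1 - b) ≤ b * R (x / a) + (1 - b) := by
      intro x y h
      have : R (y / a) ≤ R (x / a) := hm (by gcongr)
      gcongr
    have m1 : ∀ x y, x ≤ y → a * R ((y - (1 - b)) / b) ≤ a * R ((x - (1 - b)) / b) := by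
      intro x y h
      have : R ((y - (1 - b)) / b) ≤ R ((x - (1 - b)) / b) := hm (by gcongr)
      gcongr
    have ge0 : ∀ x, x ≤ p → p ≤ R' x := fun x hx => by
      rw [e0 x hx]; have := m0 x p hx; linarith
    have le1 : ∀ x, p ≤ x → R' x ≤ p := fun x hx => by
      rw [e1 x hx]; have := m1 p x hx; linarith
    have b0 : ∀ x, ((b * R x + (1 - b)) - (1 - b)) / b = R x := fun x => by field_simp; ring
    have hbx : ∀ x, 0 ≤ x → x ≤ 1 → Cn a b (n+1) x (R' x) := by
      intro x hx0 hx1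
      rcases le_total x p with hx | hx
      · have hx2 : x / a ≤ 1 := (div_le_one ha).2 (hx.trans hpa)
        have h1 := hR (x / a) (by positivity) hx2
        have h2 := Cn_box h1
        refine ⟨⟨⟨hx0, hx1⟩, ?_⟩, Or.inl ⟨hx.trans (ge0 x hx), ?_⟩⟩
        · rw [e0 x hx]; constructor <;> nlinarith
        · rw [e0 x hx, b0]; exact h1
      · have hx2 : (x - (1 - b)) / b ≤ 1 := (div_le_one hb).2 (by linarith)
        have h1 := hR ((x - (1 - b)) / b) (div_nonneg (by linarith) hb.le) hx2
        have h2 := Cn_box h1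
        have h3 := le1 x hx
        refine ⟨⟨⟨hx0, hx1⟩, ?_, by linarith⟩, Or.inr ⟨h3.trans hx, ?_⟩⟩
        · rw [e1 x hx]; exact mul_nonneg ha.le h2.2.1
        · rw [e1 x hx, mul_div_cancel_left₀ _ ha.ne']; exact h1
    refine ⟨R', ?_, ?_, ?_, ?_, hbx, p, ?_⟩
    · refine Continuous.if_le (by fun_prop) (by fun_prop) continuous_id continuous_const ?_
      intro x hx
      have hx : x = p := hx
      rw [hx, hp', hp2]
    · intro x y hxy
      rcases le_total y p with hy | hy
      · rw [e0 x (hxy.trans hy), e0 y hy]; exact m0 x y hxy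
      · rcases le_total x p with hx | hx
        · exact (le1 y hy).trans (ge0 x hx)
        · rw [e1 x hx, e1 y hy]; exact m1 x y hxy
    · intro x
      rcases le_total x p with hx | hx
      · rw [e1 _ (ge0 x hx), e0 x hx, b0, hi]; field_simp
      · rw [e0 _ (le1 x hx), e1 x hx, mul_div_cancel_left₀ _ ha.ne', hi]; field_simp; ring
    · rw [e0 0 hp0]; simp [h01]
    · have := hbx p hp0 (by
        have := (Cn_box (hR (p / a) (by positivity) hpa1)).2.2
        nlinarith)
      rwa [e0 p le_rfl, hp'] at this

lemma exists_inter (s : ℕ → Set ℝ) (hanti : ∀ n, s (n + 1) ⊆ s n) (hne : ∀ n, (s n).Nonempty)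
    (hcl : ∀ n, IsClosed (s n)) (h0 : s 0 ⊆ Icc 0 1) : ∃ t, ∀ n, t ∈ s n := by
  obtain ⟨t, ht⟩ := IsCompact.nonempty_iInter_of_sequence_nonempty_isCompact_isClosed s hanti hne
    (isCompact_Icc.of_isClosed_subset (hcl 0) h0) hcl
  exact ⟨t, mem_iInter.1 ht⟩

lemma exists_y (ha : 0 < a) (hb : 0 < b) (hb1 : b < 1) (hab : 1 ≤ a + b) {x : ℝ}
    (hx : x ∈ Icc (0:ℝ) 1) : ∃ y, Cinf a b x y := by
  refine exists_inter (fun n => {y | Cn a b n x y}) (fun n y h => Cn_anti n h) (fun n => ?_)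
    (fun n => ?_) (fun y h => h.2)
  · obtain ⟨R, -, -, -, -, h, -⟩ := exists_R ha hb hb1 hab n
    exact ⟨R x, h x hx.1 hx.2⟩
  · exact (Cn_closed n).preimage (f := fun y : ℝ => (x, y)) (by fun_prop)

lemma exists_p (ha : 0 < a) (hb : 0 < b) (hb1 : b < 1) (hab : 1 ≤ a + b) :
    ∃ p, Cinf a b p p := by
  refine exists_inter (fun n => {y | Cn a b n y y}) (fun n y h => Cn_anti n h) (fun n => ?_)
    (fun n => ?_) (fun y h => h.2)
  · obtain ⟨R, -, -, -, -, -, h⟩ := exists_R ha hb hb1 hab n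
    exact h
  · exact (Cn_closed n).preimage (f := fun y : ℝ => (y, y)) (by fun_prop)

end

lemma coding (g : Fin 2 → ℝ → ℝ) (c d p : ℝ) (h : ℝ → ℝ) (π : (ℕ → Fin 2) → ℝ)
    (hπ : ∀ σ : ℕ → Fin 2, (⋂ k : ℕ, seqComp g σ k '' Icc (0:ℝ) 1) = {π σ})
    (hS : ∀ x ∈ Icc (0:ℝ) 1, maskedT c d p x ∈ Icc (0:ℝ) 1)
    (hh : ∀ x ∈ Icc (0:ℝ) 1, h x ∈ Icc (0:ℝ) 1)
    (h0 : ∀ x ∈ Icc (0:ℝ) 1, x ≤ p → h x = g 0 (h (maskedT c d p x)))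
    (h1 : ∀ x ∈ Icc (0:ℝ) 1, p < x → h x = g 1 (h (maskedT c d p x))) :
    ∀ x ∈ Icc (0:ℝ) 1, π (itin c d p x) = h x := by
  intro x hx
  have hit : ∀ k, (maskedT c d p)^[k] x ∈ Icc (0:ℝ) 1 := by
    intro k
    induction k with
    | zero => exact hx
    | succ k ih => rw [Function.iterate_succ_apply']; exact hS _ ih
  have key : ∀ k, seqComp g (itin c d p x) k (h ((maskedT c d p)^[k] x)) = h x := by
    intro k
    induction k with
    | zero => rfl
    | succ k ih =>
      rw [← ih]
      change seqComp g (itin c d p x) k (g (itin c d p x k) _) = _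
      congr 1
      rw [Function.iterate_succ_apply']
      by_cases hk : (maskedT c d p)^[k] x ≤ p
      · rw [h0 _ (hit k) hk]; simp [itin, hk]
      · rw [h1 _ (hit k) (not_le.1 hk)]; simp [itin, hk]
  have : h x ∈ ({π (itin c d p x)} : Set ℝ) := by
    rw [← hπ, mem_iInter]
    exact fun k => ⟨_, hh _ (hit k), key k⟩
  exact (mem_singleton_iff.1 this).symm

end Helpers

/-- Let `a, b ∈ (0,1)`, `a ≥ b`, `a + b ≥ 1`. For the IFS
`F = ([0,1]; a x, b x + 1 - b)` with mask `M^{(p)} = {[0,p], (p,1]}` and masked section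
`τ_F^{(p)} = itin a b p`, and the IFS `G = ([0,1]; b x, a x + 1 - a)` with mask
`M^{(1-p)}` and masked section `τ_G^{(1-p)} = itin b a (1-p)`, there exists
`p* ∈ [1-b, a]` such that the fractal transformation `T_FG = π_G ∘ τ_F^{(p*)}` is a
homeomorphism of `[0,1]` onto itself with inverse `T_GF = π_F ∘ τ_G^{(1-p*)}`. -/
theorem overlapping_affine_fractal_homeomorphism
    (a b : ℝ) (ha : a ∈ Set.Ioo (0:ℝ) 1) (hb : b ∈ Set.Ioo (0:ℝ) 1)
    (hba : b ≤ a) (hab : 1 ≤ a + b)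
    (f g : Fin 2 → ℝ → ℝ)
    (hf0 : f 0 = fun x => a * x) (hf1 : f 1 = fun x => b * x + (1 - b))
    (hg0 : g 0 = fun x => b * x) (hg1 : g 1 = fun x => a * x + (1 - a))
    (πF πG : (ℕ → Fin 2) → ℝ)
    (hπF : ∀ σ : ℕ → Fin 2,
      (⋂ k : ℕ, seqComp f σ k '' Set.Icc (0:ℝ) 1) = {πF σ})
    (hπG : ∀ σ : ℕ → Fin 2,
      (⋂ k : ℕ, seqComp g σ k '' Set.Icc (0:ℝ) 1) = {πG σ}) :
    ∃ p ∈ Set.Icc (1 - b) a,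
      ContinuousOn (fun x => πG (itin a b p x)) (Set.Icc 0 1) ∧
      ContinuousOn (fun y => πF (itin b a (1 - p) y)) (Set.Icc 0 1) ∧
      Set.MapsTo (fun x => πG (itin a b p x)) (Set.Icc 0 1) (Set.Icc 0 1) ∧
      Set.MapsTo (fun y => πF (itin b a (1 - p) y)) (Set.Icc 0 1) (Set.Icc 0 1) ∧
      (∀ x ∈ Set.Icc (0:ℝ) 1, πF (itin b a (1 - p) (πG (itin a b p x))) = x) ∧
      (∀ y ∈ Set.Icc (0:ℝ) 1, πG (itin a b p (πF (itin b a (1 - p) y))) = y) := by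
  obtain ⟨ha0, ha1⟩ := ha
  obtain ⟨hb0, hb1⟩ := hb
  obtain ⟨p, hp⟩ := exists_p ha0 hb0 hb1 hab
  have hpm := Cn_box (Cinf_step0 hp le_rfl 0)
  have hpa : p ≤ a := (div_le_one ha0).1 hpm.1.2
  have hpb : 1 - b ≤ p := by
    have := hpm.2.1
    rw [le_div_iff₀ hb0] at this
    linarith
  have hex : ∀ x, ∃ y, x ∈ Set.Icc (0:ℝ) 1 → Cinf a b x y := by
    intro x
    by_cases hx : x ∈ Set.Icc (0:ℝ) 1
    · obtain ⟨y, hy⟩ := exists_y ha0 hb0 hb1 hab hx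
      exact ⟨y, fun _ => hy⟩
    · exact ⟨0, fun h => (hx h).elim⟩
  choose R hR using hex
  have hRm : ∀ x ∈ Set.Icc (0:ℝ) 1, R x ∈ Set.Icc (0:ℝ) 1 := fun x hx => (Cn_box (hR x hx 0)).2
  have hRu : ∀ {x y}, Cinf a b x y → R x = y := fun {x y} h =>
    Cinf_unique ha0 ha1 hb0 hba (hR x (Cn_box (h 0)).1) h
  have hRi : ∀ x ∈ Set.Icc (0:ℝ) 1, R (R x) = x := fun x hx => hRu (Cinf_symm (hR x hx))
  have hRp : R p = p := hRu hp
  have hlt : ∀ x ∈ Set.Icc (0:ℝ) 1, x < p → p < R x := fun x hx h =>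
    Cinf_strict ha0 ha1 hb0 hba (hR x hx) hp h
  have hgt : ∀ x ∈ Set.Icc (0:ℝ) 1, p < x → R x < p := fun x hx h =>
    Cinf_strict ha0 ha1 hb0 hba hp (hR x hx) h
  have hle : ∀ x ∈ Set.Icc (0:ℝ) 1, x ≤ p → x ≤ R x := fun x hx h => by
    rcases h.lt_or_eq with h | h
    · exact (h.trans (hlt x hx h)).le
    · rw [h, hRp]
  have hge : ∀ x ∈ Set.Icc (0:ℝ) 1, p ≤ x → R x ≤ x := fun x hx h => by
    rcases h.lt_or_eq with h | h
    · exact ((hgt x hx h).trans h).le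
    · rw [← h, hRp]
  -- the two functional equations
  have s0 : ∀ x ∈ Set.Icc (0:ℝ) 1, x ≤ p →
      x / a ∈ Set.Icc (0:ℝ) 1 ∧ R x = b * R (x / a) + (1 - b) := fun x hx h => by
    have h1 := Cinf_step0 (hR x hx) (hle x hx h)
    refine ⟨(Cn_box (h1 0)).1, ?_⟩
    rw [hRu h1]; field_simp; ring
  have s1 : ∀ x ∈ Set.Icc (0:ℝ) 1, p ≤ x →
      (x - (1 - b)) / b ∈ Set.Icc (0:ℝ) 1 ∧ R x = a * R ((x - (1 - b)) / b) := fun x hx h => by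
    have h1 := Cinf_step1 (hR x hx) (hge x hx h)
    refine ⟨(Cn_box (h1 0)).1, ?_⟩
    rw [hRu h1]; field_simp
  have flip : ∀ x ∈ Set.Icc (0:ℝ) 1, 1 - x ∈ Set.Icc (0:ℝ) 1 := fun x hx =>
    ⟨by linarith [hx.2], by linarith [hx.1]⟩
  have t0 : ∀ c d q x : ℝ, x ≤ q → maskedT c d q x = x / c := fun c d q x h => by
    simp [maskedT, h]
  have t1 : ∀ c d q x : ℝ, q < x → maskedT c d q x = (x - (1 - d)) / d := fun c d q x h => by
    simp [maskedT, not_le.2 h]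
  have e0 : ∀ y, (1 - y - (1 - b)) / b = 1 - y / b := fun y => by field_simp; ring
  have e1 : ∀ y, (1 - y) / a = 1 - (y - (1 - a)) / a := fun y => by field_simp; ring
  have hFG : ∀ x ∈ Set.Icc (0:ℝ) 1, πG (itin a b p x) = 1 - R x := by
    refine coding g a b p (fun x => 1 - R x) πG hπG ?_ (fun x hx => flip _ (hRm x hx)) ?_ ?_
    · intro x hx
      rcases le_or_gt x p with h | h
      · rw [t0 _ _ _ _ h]; exact (s0 x hx h).1
      · rw [t1 _ _ _ _ h]; exact (s1 x hx h.le).1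
    · intro x hx h
      simp only [t0 _ _ _ _ h, hg0]
      rw [(s0 x hx h).2]; ring
    · intro x hx h
      simp only [t1 _ _ _ _ h, hg1]
      rw [(s1 x hx h.le).2]; ring
  have hGF : ∀ y ∈ Set.Icc (0:ℝ) 1, πF (itin b a (1 - p) y) = R (1 - y) := by
    refine coding f b a (1 - p) (fun y => R (1 - y)) πF hπF ?_ (fun x hx => hRm _ (flip x hx)) ?_ ?_
    · intro y hy
      rcases le_or_gt y (1 - p) with h | h
      · rw [t0 _ _ _ _ h]
        have := flip _ (s1 _ (flip y hy) (by linarith)).1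
        rw [e0] at this; simpa using this
      · rw [t1 _ _ _ _ h]
        have := flip _ (s0 _ (flip y hy) (by linarith)).1
        rw [e1] at this; simpa using this
    · intro y hy h
      simp only [t0 _ _ _ _ h, hf0]
      rw [(s1 _ (flip y hy) (by linarith)).2, e0]
    · intro y hy h
      simp only [t1 _ _ _ _ h, hf1]
      rw [(s0 _ (flip y hy) (by linarith)).2, e1]
  -- continuity
  have hcont : ContinuousOn (fun x => 1 - R x) (Set.Icc (0:ℝ) 1) := by
    let T : Set.Icc (0:ℝ) 1 → Set.Icc (0:ℝ) 1 := fun x => ⟨1 - R x, flip _ (hRm x x.2)⟩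
    have hmono : Monotone T := by
      intro x y hxy
      rcases hxy.lt_or_eq with h | h
      · have := Cinf_strict ha0 ha1 hb0 hba (hR x x.2) (hR y y.2) h
        change 1 - R x ≤ 1 - R y
        linarith
      · rw [h]
    have hsurj : Function.Surjective T := by
      intro y
      refine ⟨⟨R (1 - y), hRm _ (flip y y.2)⟩, Subtype.ext ?_⟩
      change 1 - R (R (1 - y)) = y
      rw [hRi _ (flip y y.2)]; ring
    have hT := hmono.continuous_of_surjective hsurj
    rw [continuousOn_iff_continuous_domRestrict]
    exact continuous_subtype_val.comp hT
  have hcR : ContinuousOn R (Set.Icc (0:ℝ) 1) := by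
    have := (continuousOn_const (c := (1:ℝ))).sub hcont
    refine this.congr fun x _ => ?_
    simp
  refine ⟨p, ⟨hpb, hpa⟩, hcont.congr hFG, ?_, ?_, ?_, ?_, ?_⟩
  · refine ContinuousOn.congr ?_ hGF
    exact hcR.comp (f := fun y : ℝ => 1 - y) (by fun_prop) flip
  · intro x hx
    simp only [hFG x hx]; exact flip _ (hRm x hx)
  · intro y hy
    simp only [hGF y hy]; exact hRm _ (flip y hy)
  · intro x hx
    rw [hFG x hx, hGF _ (flip _ (hRm x hx)), sub_sub_cancel, hRi x hx]
  · intro y hy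
    rw [hGF y hy, hFG _ (hRm _ (flip y hy)), hRi _ (flip y hy), sub_sub_cancel]
end
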